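/- arXiv:math/0109213 — 2 statements merged into one kernel-verified Lean document; each statement's English description precedes it below -/
import Mathlib

section
/- (Discrete Kneser criterion, nonoscillatory case.) Let b : ℕ → ℝ. If liminf_{n→∞} n²(b(n) - 2) > -1/4, then the Jacobi difference expression with a(n) = -1 and potential b is nonoscillatory: every nontrivial real solution u of -u(n+1) - u(n-1) + b(n)u(n) = 0 (n ≥ 1) has only finitely many sign flips (nodes). -/
open Filter Finset

/-- The square root is a supersolution of the critical discrete Euler equation. -/
lemma sqrt_add_one_add_sqrt_sub_one_le {x : ℝ} (hx : 1 ≤ x) :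
    √(x + 1) + √(x - 1) ≤ (2 - 1 / (4 * x ^ 2)) * √x := by
  have hx0 : 0 < x := by linarith
  have hprod : √(x + 1) * √(x - 1) ≤ x - 1 / (2 * x) := by
    rw [← Real.sqrt_mul (by linarith)]
    have h1 : 1 / (2 * x) ≤ 1 := by
      rw [div_le_one (by positivity)]
      linarith
    refine Real.sqrt_le_iff.mpr ⟨by linarith, ?_⟩
    have h2 : (x - 1 / (2 * x)) ^ 2 = (x + 1) * (x - 1) + (1 / (2 * x)) ^ 2 := by
      field_simp
      ring
    rw [h2]
    linarith [sq_nonneg (1 / (2 * x))]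
  have hcoef : 0 ≤ 2 - 1 / (4 * x ^ 2) := by
    have : 1 / (4 * x ^ 2) ≤ 1 := by
      rw [div_le_one (by positivity)]
      nlinarith
    linarith
  refine abs_le_of_sq_le_sq' ?_ (mul_nonneg hcoef (Real.sqrt_nonneg x)) |>.2
  have h1 := Real.sq_sqrt (show 0 ≤ x + 1 by linarith)
  have h2 := Real.sq_sqrt (show 0 ≤ x - 1 by linarith)
  have h3 : ((2 - 1 / (4 * x ^ 2)) * √x) ^ 2 = 4 * x - 1 / x + 1 / (16 * x ^ 3) := by
    rw [mul_pow, Real.sq_sqrt hx0.le]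
    field_simp
    ring
  have h4 : 1 / x = 2 * (1 / (2 * x)) := by
    field_simp
  have h5 : 0 ≤ 1 / (16 * x ^ 3) := by positivity
  rw [h3, h4]
  nlinarith

/-- Discrete Sturm comparison: above a positive supersolution `v`, a solution that has crossed zero
upwards stays positive. -/
lemma pos_of_crossing_of_supersolution {b u v : ℕ → ℝ} {m : ℕ}
    (hu : ∀ n, m ≤ n → u (n + 2) + u n = b (n + 1) * u (n + 1))
    (hv : ∀ n, m ≤ n → v (n + 2) + v n ≤ b (n + 1) * v (n + 1))
    (hpos : ∀ n, m ≤ n → 0 < v n) (h0 : u m ≤ 0) (h1 : 0 < u (m + 1)) :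
    ∀ n, m + 1 ≤ n → 0 < u n := by
  have key : ∀ n, m ≤ n → 0 < u (n + 1) ∧ u n * v (n + 1) ≤ u (n + 1) * v n := by
    intro n hn
    induction n, hn using Nat.le_induction with
    | base =>
      have a := mul_pos h1 (hpos m le_rfl)
      have c := mul_nonneg (neg_nonneg.mpr h0) (hpos (m + 1) (by omega)).le
      exact ⟨h1, by linarith⟩
    | succ n hn ih =>
      obtain ⟨hp, hd⟩ := ih
      have hvn := hpos (n + 1) (by omega)
      have hd' : u (n + 1) * v (n + 2) ≤ u (n + 2) * v (n + 1) := by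
        have e := congrArg (· * v (n + 1)) (hu n hn)
        have f := mul_le_mul_of_nonneg_left (hv n hn) hp.le
        linarith
      exact ⟨pos_of_mul_pos_left ((mul_pos hp (hpos (n + 2) (by omega))).trans_le hd') hvn.le, hd'⟩
  intro n hn
  obtain ⟨k, rfl⟩ := Nat.exists_eq_add_of_le' (show 1 ≤ n by omega)
  exact (key k (by omega)).1

/-- A solution of a three-term recurrence with two consecutive zeros vanishes identically. -/
lemma eq_zero_of_consecutive_zeros {b u : ℕ → ℝ}
    (hu : ∀ n, u (n + 2) + u n = b (n + 1) * u (n + 1)) {m : ℕ}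
    (h0 : u m = 0) (h1 : u (m + 1) = 0) : u = 0 := by
  have start : u 0 = 0 ∧ u 1 = 0 := by
    induction m with
    | zero => exact ⟨h0, h1⟩
    | succ m ih =>
      refine ih ?_ h0
      have := hu m
      rw [h0, h1] at this
      linarith
  have all : ∀ n, u n = 0 ∧ u (n + 1) = 0 := by
    intro n
    induction n with
    | zero => exact start
    | succ n ih =>
      refine ⟨ih.2, ?_⟩
      have := hu n
      rw [ih.1, ih.2] at this
      linarith
  exact funext fun n => (all n).1

/-- Discrete Kneser criterion, nonoscillatory case. -/
theorem kneser_nonoscillatory (b : ℕ → ℝ)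
    (hliminf : ((-(1 / 4) : ℝ) : EReal) <
      liminf (fun n : ℕ => (((n : ℝ) ^ 2 * (b n - 2) : ℝ) : EReal)) atTop) :
    ∀ u : ℕ → ℝ, u ≠ 0 →
      (∀ n, 1 ≤ n → -u (n + 1) - u (n - 1) + b n * u n = 0) →
      {n : ℕ | u n = 0 ∨ u n * u (n + 1) < 0}.Finite := by
  intro u hne hrec
  have hu : ∀ n, u (n + 2) + u n = b (n + 1) * u (n + 1) := by
    intro n
    have h : -u (n + 2) - u n + b (n + 1) * u (n + 1) = 0 := hrec (n + 1) (by omega)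
    linarith
  obtain ⟨N, hN⟩ := eventually_atTop.mp (eventually_lt_of_lt_liminf hliminf)
  have hv : ∀ n, N ≤ n → √((n + 2 : ℕ) : ℝ) + √(n : ℝ) ≤ b (n + 1) * √((n + 1 : ℕ) : ℝ) := by
    intro n hn
    have hb := EReal.coe_lt_coe_iff.mp (hN (n + 1) (by omega))
    have hx : (1 : ℝ) ≤ ((n + 1 : ℕ) : ℝ) := by exact_mod_cast Nat.succ_pos n
    have hs := sqrt_add_one_add_sqrt_sub_one_le hx
    have e1 : ((n + 1 : ℕ) : ℝ) + 1 = ((n + 2 : ℕ) : ℝ) := by push_cast; ring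
    have e2 : ((n + 1 : ℕ) : ℝ) - 1 = n := by push_cast; ring
    rw [e1, e2] at hs
    refine hs.trans (mul_le_mul_of_nonneg_right ?_ (Real.sqrt_nonneg _))
    generalize ((n + 1 : ℕ) : ℝ) = x at hb hx
    have hx2 : 0 < x ^ 2 := by positivity
    have : 2 - b (n + 1) ≤ 1 / (4 * x ^ 2) := by
      rw [le_div_iff₀ (by positivity)]
      linarith
    linarith
  by_contra hinf
  obtain ⟨m, hm, hmN⟩ := Set.Infinite.exists_gt hinf N
  have hm1 : u (m + 1) ≠ 0 := by
    intro h
    rcases hm with h0 | h0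
    · exact hne (eq_zero_of_consecutive_zeros hu h0 h)
    · simp [h] at h0
  have hpos : ∀ n, m ≤ n → 0 < √(n : ℝ) := fun n hn =>
    Real.sqrt_pos.mpr (by exact_mod_cast (by omega : 0 < n))
  have hvm : ∀ n, m ≤ n → √((n + 2 : ℕ) : ℝ) + √(n : ℝ) ≤ b (n + 1) * √((n + 1 : ℕ) : ℝ) :=
    fun n hn => hv n (by omega)
  have hsign : ∀ n, m + 1 ≤ n → 0 < u n * u (n + 1) := by
    intro n hn
    rcases hm1.lt_or_gt with hneg | hgt
    · have h0 : -u m ≤ 0 := by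
        rcases hm with h | h
        · simp [h]
        · nlinarith
      have h := pos_of_crossing_of_supersolution (b := b) (u := fun n => -u n)
        (v := fun n => √(n : ℝ)) (fun n _ => by linarith [hu n]) hvm hpos h0 (by linarith)
      nlinarith [mul_pos (h n hn) (h (n + 1) (by omega))]
    · have h0 : u m ≤ 0 := by
        rcases hm with h | h
        · simp [h]
        · nlinarith
      have h := pos_of_crossing_of_supersolution (b := b) (u := u)
        (v := fun n => √(n : ℝ)) (fun n _ => hu n) hvm hpos h0 hgt
      exact mul_pos (h n hn) (h (n + 1) (by omega))
  obtain ⟨k, hk, hkm⟩ := Set.Infinite.exists_gt hinf m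
  have := hsign k hkm
  rcases hk with h | h
  · simp [h] at this
  · linarith
end

section
/- (Discrete Kneser criterion, oscillatory case.) Let b : ℕ → ℝ. If limsup_{n→∞} n²(b(n) - 2) < -1/4, then the Jacobi difference expression with a(n) = -1 and potential b is oscillatory: every nontrivial real solution u of -u(n+1) - u(n-1) + b(n)u(n) = 0 (n ≥ 1) has infinitely many sign flips (nodes). -/
open Filter Finset

/-- A positive solution of the Riccati inequality `r (n + 1) ≤ 2 - 1 / r n` stays above `1`. -/
theorem one_le_of_riccati_le {r : ℕ → ℝ} {N : ℕ} (hpos : ∀ n, N ≤ n → 0 < r n)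
    (hr : ∀ n, N ≤ n → r (n + 1) ≤ 2 - 1 / r n) {k : ℕ} (hk : N ≤ k) : 1 ≤ r k := by
  by_contra! hlt
  have hε : 0 < (1 - r k) ^ 2 := by nlinarith
  have bound : ∀ m : ℕ, r (k + m) ≤ r k - m * (1 - r k) ^ 2 := by
    intro m
    induction m with
    | zero => simp
    | succ m ih =>
      have h0 := hpos (k + m) (by omega)
      have h1 := hr (k + m) (by omega)
      have hle : r (k + m) ≤ r k := by
        have : 0 ≤ (m : ℝ) * (1 - r k) ^ 2 := by positivity
        linarith
      have h2 : 2 - 1 / r (k + m) ≤ r (k + m) - (1 - r (k + m)) ^ 2 := by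
        have h3 : r (k + m) - (1 - r (k + m)) ^ 2 - (2 - 1 / r (k + m)) =
            (1 - r (k + m)) ^ 3 / r (k + m) := by
          field_simp
          ring
        have h4 : 0 ≤ (1 - r (k + m)) ^ 3 / r (k + m) :=
          div_nonneg (pow_nonneg (by linarith) 3) h0.le
        linarith
      have h5 : (1 - r k) ^ 2 ≤ (1 - r (k + m)) ^ 2 :=
        pow_le_pow_left₀ (by linarith) (by linarith) 2
      rw [← add_assoc]
      push_cast
      linarith
  obtain ⟨m, hm⟩ := exists_nat_gt (1 / (1 - r k) ^ 2)
  rw [div_lt_iff₀ hε] at hm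
  have := bound m
  have := hpos (k + m) (by omega)
  linarith

/-- One step of the Riccati inequality with an inverse-square perturbation, in the variable
`n * (r n - 1)`. -/
theorem riccati_step_le {x r s c : ℝ} (hx : 1 ≤ x) (hr : 1 ≤ r)
    (hs : s ≤ 2 - 1 / r - c / (x + 1) ^ 2) :
    (x + 1) * (s - 1) ≤ x * (r - 1) + 1 / (4 * x) - c / (x + 1) := by
  have h1 : (x + 1) * (s - 1) ≤ (x + 1) * (2 - 1 / r - c / (x + 1) ^ 2 - 1) := by
    gcongr
  have h2 : (x + 1) * (2 - 1 / r - c / (x + 1) ^ 2 - 1) =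
      (x + 1) * (r - 1) / r - c / (x + 1) := by
    field_simp
    ring
  have h3 : x * (r - 1) + 1 / (4 * x) - (x + 1) * (r - 1) / r =
      ((2 * x * (r - 1) - 1) ^ 2 + (r - 1)) / (4 * x * r) := by
    field_simp
    ring
  have h4 : 0 ≤ ((2 * x * (r - 1) - 1) ^ 2 + (r - 1)) / (4 * x * r) := by
    have : 0 ≤ r - 1 := by linarith
    positivity
  linarith

/-- The Riccati inequality with perturbation `-c / (n + 1) ^ 2`, `c > 1 / 4`, has no eventually
positive solution. -/
theorem not_forall_riccati_le {r : ℕ → ℝ} {N : ℕ} {c : ℝ} (hc : 1 / 4 < c)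
    (hpos : ∀ n, N ≤ n → 0 < r n) :
    ¬ ∀ n : ℕ, N ≤ n → r (n + 1) ≤ 2 - 1 / r n - c / ((n : ℝ) + 1) ^ 2 := by
  intro hr
  have hone : ∀ n, N ≤ n → 1 ≤ r n := fun n hn =>
    one_le_of_riccati_le hpos (fun m hm => (hr m hm).trans (sub_le_self _ (by positivity))) hn
  obtain ⟨δ, hδ, rfl⟩ : ∃ δ : ℝ, 0 < δ ∧ c = 1 / 4 + 2 * δ :=
    ⟨(c - 1 / 4) / 2, by linarith, by ring⟩
  obtain ⟨K, hK⟩ := exists_nat_gt (1 / (4 * δ))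
  set M := max (max N K) 1
  let H : ℕ → ℝ := fun n => ∑ i ∈ range n, 1 / ((i : ℝ) + 1)
  have hstep : ∀ n, M ≤ n →
      ((n + 1 : ℕ) : ℝ) * (r (n + 1) - 1) + δ * H (n + 1) ≤ n * (r n - 1) + δ * H n := by
    intro n hn
    have hNn : N ≤ n := by omega
    have hKn : (K : ℝ) ≤ n := by exact_mod_cast (by omega : K ≤ n)
    have h1n : (1 : ℝ) ≤ n := by exact_mod_cast (by omega : 1 ≤ n)
    have h := riccati_step_le h1n (hone n hNn) (hr n hNn)
    have hle : 1 / (4 * (n : ℝ)) ≤ (1 / 4 + δ) / ((n : ℝ) + 1) := by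
      have h4 : 1 < (n : ℝ) * (4 * δ) := (div_lt_iff₀ (by positivity)).1 (hK.trans_le hKn)
      rw [div_le_div_iff₀ (by positivity) (by positivity)]
      linarith
    have hH : H (n + 1) = H n + 1 / ((n : ℝ) + 1) := sum_range_succ _ n
    have hsplit : (1 / 4 + 2 * δ) / ((n : ℝ) + 1) =
        (1 / 4 + δ) / ((n : ℝ) + 1) + δ * (1 / ((n : ℝ) + 1)) := by ring
    rw [hH]
    push_cast
    linarith
  have hbound : ∀ n, M ≤ n → n * (r n - 1) + δ * H n ≤ M * (r M - 1) + δ * H M := by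
    intro n hn
    induction n, hn using Nat.le_induction with
    | base => exact le_rfl
    | succ n hn ih => exact (hstep n hn).trans ih
  obtain ⟨n, hnM, hn⟩ := ((eventually_ge_atTop M).and
    (Real.tendsto_sum_range_one_div_nat_succ_atTop.eventually_gt_atTop
      ((M * (r M - 1) + δ * H M) / δ))).exists
  rw [div_lt_iff₀ hδ] at hn
  have h0 : 0 ≤ (n : ℝ) * (r n - 1) :=
    mul_nonneg n.cast_nonneg (by linarith [hone n (by omega)])
  have hHn : H n = ∑ i ∈ range n, 1 / ((i : ℝ) + 1) := rfl
  have := hbound n hnM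
  linarith

/-- Discrete Kneser criterion, oscillatory case. -/
theorem kneser_oscillatory (b : ℕ → ℝ)
    (hlimsup : limsup (fun n : ℕ => (((n : ℝ) ^ 2 * (b n - 2) : ℝ) : EReal)) atTop <
      ((-(1 / 4) : ℝ) : EReal)) :
    ∀ u : ℕ → ℝ, u ≠ 0 →
      (∀ n, 1 ≤ n → -u (n + 1) - u (n - 1) + b n * u n = 0) →
      {n : ℕ | u n = 0 ∨ u n * u (n + 1) < 0}.Infinite := by
  intro u _ hu hfin
  obtain ⟨d, hd1, hd2⟩ := EReal.lt_iff_exists_real_btwn.1 hlimsup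
  have hd : d < -(1 / 4) := EReal.coe_lt_coe_iff.1 hd2
  obtain ⟨K, hK⟩ := eventually_atTop.1 (eventually_lt_of_limsup_lt hd1)
  obtain ⟨B, hB⟩ := hfin.bddAbove
  have hnode : ∀ n, B + 1 ≤ n → u n ≠ 0 ∧ 0 ≤ u n * u (n + 1) := by
    intro n hn
    by_contra hcon
    have : n ≤ B := hB (by
      by_cases h : u n = 0
      · exact Or.inl h
      · exact Or.inr (not_le.1 fun h' => hcon ⟨h, h'⟩))
    omega
  have hpos : ∀ n, max (B + 1) K ≤ n → 0 < u (n + 1) / u n := by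
    intro n hn
    obtain ⟨h0, h1⟩ := hnode n (by omega)
    have h2 := (hnode (n + 1) (by omega)).1
    have h3 : 0 < u n * u (n + 1) := lt_of_le_of_ne h1 (mul_ne_zero h0 h2).symm
    have h4 : u (n + 1) / u n = u n * u (n + 1) / u n ^ 2 := by field_simp
    rw [h4]
    positivity
  refine not_forall_riccati_le (r := fun n => u (n + 1) / u n) (c := -d) (by linarith) hpos ?_
  intro n hn
  have h0 := (hnode n (by omega)).1
  have h1 := (hnode (n + 1) (by omega)).1
  have heq := hu (n + 1) (by omega)
  have hb : ((n : ℝ) + 1) ^ 2 * (b (n + 1) - 2) < d := by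
    exact_mod_cast hK (n + 1) (by omega)
  have hb' : b (n + 1) - 2 ≤ d / ((n : ℝ) + 1) ^ 2 := by
    rw [le_div_iff₀ (by positivity)]
    linarith
  have hr : u (n + 1 + 1) / u (n + 1) = b (n + 1) - 1 / (u (n + 1) / u n) := by
    simp only [Nat.add_sub_cancel] at heq
    field_simp
    linarith
  have hneg : -d / ((n : ℝ) + 1) ^ 2 = -(d / ((n : ℝ) + 1) ^ 2) := neg_div _ _
  change u (n + 1 + 1) / u (n + 1) ≤ _
  rw [hr, hneg]
  linarith
end
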